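/- arXiv:2005.00646 — 4 statements merged into one kernel-verified Lean document; each statement's English description precedes it below -/
import Mathlib

section
/- Let E ⊆ V × R × V be a multi-relational graph on n nodes with m relation types, with adjacency matrices A_r. Let φ : V → T be a node type map into a finite type T, let f, g : T → ℝ, δ : R → ℝ, τ : R × R → ℝ, and define for each k-hop relational path the attention score α(j, r_1, ..., r_k, i) = exp(f(φ(j)) + Σ_{t=1}^{k} δ(r_t) + Σ_{t=1}^{k-1} τ(r_t, r_{t+1}) + g(φ(i))), and β(r_1, ..., r_k) = exp(Σ_{t=1}^{k} δ(r_t) + Σ_{t=1}^{k-1} τ(r_t, r_{t+1})). Let X ∈ ℝ^{n×d} be a node-feature matrix with rows x_v, let W_r^t ∈ ℝ^{d×d} (r ∈ R, 1 ≤ t ≤ k) be weight matrices, and set F = diag(exp(f(φ(v_1))), ..., exp(f(φ(v_n)))) and G = diag(exp(g(φ(v_1))), ..., exp(g(φ(v_n)))). Then for every node i ∈ V, the vector Σ over all k-hop relational paths (j, r_1, ..., r_k, i) ∈ Φ_k ending at i of α(j, r_1, ..., r_k, i) · W_{r_k}^k ⋯ W_{r_1}^1 x_j equals the i-th row of the matrix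 Σ_{(r_1, ..., r_k) ∈ R^k} β(r_1, ..., r_k) · G · A_{r_k} ⋯ A_{r_1} · F · X · (W_{r_1}^1)^⊤ ⋯ (W_{r_k}^k)^⊤. -/
theorem List.prod_ofFn_rev_succ {M : Type*} [Monoid M] (k : ℕ) (B : Fin (k + 1) → M) :
    (List.ofFn fun t => B t.rev).prod =
      B (Fin.last k) * (List.ofFn fun t : Fin k => B t.rev.castSucc).prod := by
  simp [List.ofFn_succ, Fin.rev_succ]

/-- Entries of a matrix product as a weighted sum over walks with a fixed endpoint. -/
theorem Matrix.sum_walks_smul {V K M : Type*} [Fintype V] [DecidableEq V] [CommSemiring K]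
    [AddCommMonoid M] [Module K M] (k : ℕ) (B : Fin k → Matrix V V K) (h : V → M) (i : V) :
    (∑ q : Fin (k + 1) → V, if q (Fin.last k) = i then
        (∏ t : Fin k, B t (q t.succ) (q t.castSucc)) • h (q 0) else 0) =
      ∑ j, (List.ofFn fun t => B t.rev).prod i j • h j := by
  induction k generalizing i with
  | zero =>
    rw [← (Equiv.funUnique (Fin 1) V).symm.sum_comp]
    simp [Matrix.one_apply]
  | succ k ih =>
    rw [List.prod_ofFn_rev_succ, ← (Fin.snocEquiv fun _ : Fin (k + 2) => V).sum_comp,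
      Fintype.sum_prod_type]
    have hsplit : ∀ v : V, ∀ q : Fin (k + 1) → V,
        (∏ t : Fin (k + 1), B t (Fin.snoc (α := fun _ : Fin (k + 2) => V) q v t.succ)
            (Fin.snoc (α := fun _ : Fin (k + 2) => V) q v t.castSucc)) =
          (∏ t : Fin k, B t.castSucc (q t.succ) (q t.castSucc)) *
            B (Fin.last k) v (q (Fin.last k)) := by
      intro v q
      rw [Fin.prod_univ_castSucc]
      simp only [Fin.succ_last, Fin.snoc_last, Fin.succ_castSucc, Fin.snoc_castSucc]
    have hzero : ∀ v : V, ∀ q : Fin (k + 1) → V,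
        Fin.snoc (α := fun _ : Fin (k + 2) => V) q v 0 = q 0 := fun v q =>
      Fin.snoc_castSucc (α := fun _ : Fin (k + 2) => V) v q 0
    simp only [Fin.snocEquiv, Equiv.coe_fn_mk, Fin.snoc_last, hsplit, hzero]
    rw [Finset.sum_eq_single i (fun v _ hv => by simp [hv]) (by simp)]
    simp only [Matrix.mul_apply, Finset.sum_smul, if_true]
    rw [Finset.sum_comm]
    simp only [mul_smul]
    simp only [← Finset.smul_sum, ← ih (fun t => B t.castSucc)]
    simp only [Finset.smul_sum]
    rw [Finset.sum_comm]
    refine Finset.sum_congr rfl fun q _ => ?_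
    rw [Finset.sum_eq_single (q (Fin.last k)) (fun v _ hv => by simp [hv.symm]) (by simp)]
    simp [smul_smul, mul_comm]

theorem Matrix.sum_row {ι V U K : Type*} [AddCommMonoid K] (s : Finset ι)
    (M : ι → Matrix V U K) (i : V) : (∑ c ∈ s, M c) i = ∑ c ∈ s, M c i := by
  ext j
  rw [Matrix.sum_apply, Finset.sum_apply]

theorem Matrix.prod_ofFn_transpose {U K : Type*} [Fintype U] [DecidableEq U] [CommSemiring K]
    (k : ℕ) (S : Fin k → Matrix U U K) :
    (List.ofFn fun t => (S t).transpose).prod =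
      (List.ofFn fun t => S t.rev).prod.transpose := by
  induction k with
  | zero => simp
  | succ k ih =>
    rw [List.ofFn_succ', List.concat_eq_append, List.prod_append, List.prod_singleton,
      ih fun t => S t.castSucc, List.prod_ofFn_rev_succ, Matrix.transpose_mul]

theorem Matrix.smul_mul_transpose_row {V U K : Type*} [Fintype U] [CommSemiring K]
    (c : K) (M : Matrix V U K) (S : Matrix U U K) (i : V) :
    (c • (M * S.transpose)) i = c • S.mulVec (M i) := by
  ext j
  simp [Matrix.mul_apply, Matrix.mulVec, dotProduct, mul_comm]

/-- The attention-weighted multi-hop message at node `i`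
(sum over all `(k+1)`-hop relational paths ending at `i` of
`α(j, r_1, …, r_{k+1}, i) · W^{k+1}_{r_{k+1}} ⋯ W^1_{r_1} x_j`)
equals the `i`-th row of
`Σ_{(r_1, …, r_{k+1}) ∈ R^{k+1}} β(r_1, …, r_{k+1}) · G · A_{r_{k+1}} ⋯ A_{r_1} · F · X ·
(W^1_{r_1})ᵀ ⋯ (W^{k+1}_{r_{k+1}})ᵀ`. -/
theorem stmt_3 (n m d : ℕ) (E : Finset (Fin n × Fin m × Fin n))
    (A : Fin m → Matrix (Fin n) (Fin n) ℝ)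
    (hA : ∀ (r : Fin m) (i j : Fin n), A r i j = if (j, r, i) ∈ E then 1 else 0)
    (T : Type*) [Fintype T] (φ : Fin n → T)
    (f g : T → ℝ) (δ : Fin m → ℝ) (τ : Fin m → Fin m → ℝ)
    (k : ℕ)
    (X : Matrix (Fin n) (Fin d) ℝ)
    (W : Fin (k + 1) → Fin m → Matrix (Fin d) (Fin d) ℝ)
    (F G : Matrix (Fin n) (Fin n) ℝ)
    (hF : F = Matrix.diagonal fun v => Real.exp (f (φ v)))
    (hG : G = Matrix.diagonal fun v => Real.exp (g (φ v)))
    (i : Fin n) :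
    (∑ p ∈ Finset.univ.filter
        (fun p : (Fin (k + 2) → Fin n) × (Fin (k + 1) → Fin m) =>
          p.1 (Fin.last (k + 1)) = i ∧
          ∀ t : Fin (k + 1), (p.1 t.castSucc, p.2 t, p.1 t.succ) ∈ E),
      Real.exp (f (φ (p.1 0)) + (∑ t : Fin (k + 1), δ (p.2 t)) +
          (∑ t : Fin k, τ (p.2 t.castSucc) (p.2 t.succ)) + g (φ i)) •
        ((List.ofFn fun t : Fin (k + 1) => W t.rev (p.2 t.rev)).prod.mulVec (X (p.1 0))))
      = (∑ r : Fin (k + 1) → Fin m,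
          Real.exp ((∑ t : Fin (k + 1), δ (r t)) +
              ∑ t : Fin k, τ (r t.castSucc) (r t.succ)) •
            (G * (List.ofFn fun t : Fin (k + 1) => A (r t.rev)).prod * F * X *
              (List.ofFn fun t : Fin (k + 1) => (W t (r t)).transpose).prod)) i := by
  subst hF hG
  rw [Finset.sum_filter, Fintype.sum_prod_type_right, Matrix.sum_row]
  refine Finset.sum_congr rfl fun r _ => ?_
  have hS : (List.ofFn fun t : Fin (k + 1) => (W t (r t)).transpose).prod =
      (List.ofFn fun t : Fin (k + 1) => W t.rev (r t.rev)).prod.transpose :=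
    Matrix.prod_ofFn_transpose (k + 1) fun t => W t (r t)
  set S := (List.ofFn fun t : Fin (k + 1) => W t.rev (r t.rev)).prod
  have hwalk := Matrix.sum_walks_smul (k + 1) (fun t => A (r t))
    (fun j => Real.exp (f (φ j)) • S.mulVec (X j)) i
  rw [hS, Matrix.smul_mul_transpose_row]
  have hrow : (Matrix.diagonal (fun v => Real.exp (g (φ v))) *
      (List.ofFn fun t : Fin (k + 1) => A (r t.rev)).prod *
      Matrix.diagonal (fun v => Real.exp (f (φ v))) * X) i =
      Real.exp (g (φ i)) • ∑ j, (List.ofFn fun t : Fin (k + 1) => A (r t.rev)).prod i j •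
        Real.exp (f (φ j)) • X j := by
    ext c
    generalize (List.ofFn fun t : Fin (k + 1) => A (r t.rev)).prod = P
    rw [Matrix.mul_apply]
    simp [Matrix.mul_diagonal, Matrix.diagonal_mul, Finset.mul_sum, mul_assoc]
  rw [hrow, Matrix.mulVec_smul, Matrix.mulVec_sum]
  simp only [Matrix.mulVec_smul]
  rw [← hwalk, Finset.smul_sum, Finset.smul_sum]
  refine Finset.sum_congr rfl fun q _ => ?_
  simp only [hA, Finset.prod_ite_zero, Finset.prod_const_one, Finset.mem_univ, true_imp_iff,
    Real.exp_add]
  by_cases hi : q (Fin.last (k + 1)) = i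
  · by_cases hE : ∀ t : Fin (k + 1), (q t.castSucc, r t, q t.succ) ∈ E
    · rw [if_pos ⟨hi, hE⟩, if_pos hi, if_pos hE, one_smul, smul_smul, smul_smul]
      congr 1
      ring
    · rw [if_neg fun h => hE h.2, if_pos hi, if_neg hE, zero_smul, smul_zero, smul_zero]
  · rw [if_neg fun h => hi h.1, if_neg hi, smul_zero, smul_zero]
end

section
/- Let E ⊆ V × R × V be a multi-relational graph on n nodes with m relation types, with adjacency matrices A_r; let δ : R → ℝ, τ : R × R → ℝ, let F ∈ ℝ^{n×n} be any diagonal matrix, X ∈ ℝ^{n×d} any matrix, and W_r^t ∈ ℝ^{d×d} (r ∈ R, t ≥ 1) weight matrices. Define matrices M_r^{(k)} ∈ ℝ^{n×d} recursively by M_r^{(1)} = e^{δ(r)} · A_r · F · X · (W_r^1)^⊤ and, for k ≥ 2, M_r^{(k)} = e^{δ(r)} · A_r · (Σ_{r' ∈ R} e^{τ(r', r)} M_{r'}^{(k-1)}) · (W_r^k)^⊤. Then for every k ≥ 1 and r ∈ R, M_r^{(k)} = Σ over relation sequences (r_1, ..., r_k) ∈ R^k with r_k = r of exp(Σ_{t=1}^{k}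 δ(r_t) + Σ_{t=1}^{k-1} τ(r_t, r_{t+1})) · A_{r_k} ⋯ A_{r_1} · F · X · (W_{r_1}^1)^⊤ ⋯ (W_{r_k}^k)^⊤. (This is the correctness of the dynamic-programming Algorithm 1, which computes the m^k-term sum with only k sequential stages.) -/
theorem sum_filter_last_eq {ι M : Type*} [Fintype ι] [DecidableEq ι] [AddCommMonoid M]
    (k : ℕ) (r : ι) (f : (Fin (k + 1) → ι) → M) :
    ∑ s ∈ Finset.univ.filter (fun s : Fin (k + 1) → ι => s (Fin.last k) = r), f s
      = ∑ s : Fin k → ι, f (Fin.snoc s r : Fin (k + 1) → ι) := by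
  refine Finset.sum_bij' (fun s _ => fun t => s t.castSucc)
    (fun s _ => (Fin.snoc s r : Fin (k + 1) → ι)) (by simp) (by simp) ?_ (by simp) ?_
  all_goals
    intro s hs
    have h : (Fin.snoc (fun t => s t.castSucc) r : Fin (k + 1) → ι) = s := by
      rw [← (Finset.mem_filter.mp hs).2]
      exact Fin.snoc_init_self s
    rw [h]

/-- The contribution of one relation sequence to the multi-hop message. -/
noncomputable def pathTerm {ι : Type*} {n d : ℕ} (A : ι → Matrix (Fin n) (Fin n) ℝ)
    (δ : ι → ℝ) (τ : ι → ι → ℝ) (F : Matrix (Fin n) (Fin n) ℝ) (X : Matrix (Fin n) (Fin d) ℝ)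
    (W : ℕ → ι → Matrix (Fin d) (Fin d) ℝ) (k : ℕ) (s : Fin (k + 1) → ι) :
    Matrix (Fin n) (Fin d) ℝ :=
  Real.exp ((∑ t : Fin (k + 1), δ (s t)) + ∑ t : Fin k, τ (s t.castSucc) (s t.succ)) •
    ((List.ofFn fun t : Fin (k + 1) => A (s t.rev)).prod * F * X *
      (List.ofFn fun t : Fin (k + 1) => (W ((t : ℕ) + 1) (s t)).transpose).prod)

theorem pathTerm_snoc {ι : Type*} {n d : ℕ} (A : ι → Matrix (Fin n) (Fin n) ℝ)
    (δ : ι → ℝ) (τ : ι → ι → ℝ) (F : Matrix (Fin n) (Fin n) ℝ) (X : Matrix (Fin n) (Fin d) ℝ)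
    (W : ℕ → ι → Matrix (Fin d) (Fin d) ℝ) (k : ℕ) (s : Fin (k + 1) → ι) (r : ι) :
    pathTerm A δ τ F X W (k + 1) (Fin.snoc s r : Fin (k + 2) → ι) =
      Real.exp (δ r) • (A r * (Real.exp (τ (s (Fin.last k)) r) • pathTerm A δ τ F X W k s) *
        (W (k + 2) r).transpose) := by
  have hA : (List.ofFn fun t : Fin (k + 2) => A ((Fin.snoc s r : Fin (k + 2) → ι) t.rev)).prod
      = A r * (List.ofFn fun t : Fin (k + 1) => A (s t.rev)).prod := by
    rw [List.ofFn_succ, List.prod_cons]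
    simp only [Fin.rev_zero, Fin.rev_succ, Fin.snoc_last, Fin.snoc_castSucc]
  have hW : (List.ofFn fun t : Fin (k + 2) =>
        (W ((t : ℕ) + 1) ((Fin.snoc s r : Fin (k + 2) → ι) t)).transpose).prod
      = (List.ofFn fun t : Fin (k + 1) => (W ((t : ℕ) + 1) (s t)).transpose).prod *
        (W (k + 2) r).transpose := by
    rw [List.ofFn_succ', List.concat_eq_append, List.prod_append, List.prod_singleton]
    simp only [Fin.snoc_last, Fin.snoc_castSucc, Fin.val_castSucc, Fin.val_last]
  have hδ : ∑ t, δ ((Fin.snoc s r : Fin (k + 2) → ι) t) = (∑ t, δ (s t)) + δ r := by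
    rw [Fin.sum_univ_castSucc]
    simp only [Fin.snoc_last, Fin.snoc_castSucc]
  have hτ : ∑ t : Fin (k + 1), τ ((Fin.snoc s r : Fin (k + 2) → ι) t.castSucc)
        ((Fin.snoc s r : Fin (k + 2) → ι) t.succ)
      = (∑ t : Fin k, τ (s t.castSucc) (s t.succ)) + τ (s (Fin.last k)) r := by
    rw [Fin.sum_univ_castSucc]
    simp only [Fin.succ_last, Fin.succ_castSucc, Fin.snoc_last, Fin.snoc_castSucc]
  unfold pathTerm
  rw [hA, hW, hδ, hτ]
  simp only [Matrix.mul_smul, Matrix.smul_mul, smul_smul, Matrix.mul_assoc, ← Real.exp_add]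
  congr 2
  ring


/-- Correctness of the dynamic-programming recursion for multi-hop
message passing: with `M r (k)` (indexed so that `M k r` is `M_r^{(k+1)}` of the paper)
defined by the recursion
`M_r^{(1)} = e^{δ(r)} A_r F X (W^1_r)ᵀ` and
`M_r^{(k)} = e^{δ(r)} A_r (Σ_{r'} e^{τ(r',r)} M_{r'}^{(k-1)}) (W^k_r)ᵀ`,
`M_r^{(k)}` equals the sum over relation sequences `(r_1, …, r_k)` with `r_k = r` of
`exp(Σ δ + Σ τ) · A_{r_k} ⋯ A_{r_1} · F · X · (W^1_{r_1})ᵀ ⋯ (W^k_{r_k})ᵀ`. -/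
theorem stmt_4 (n m d : ℕ) (E : Finset (Fin n × Fin m × Fin n))
    (A : Fin m → Matrix (Fin n) (Fin n) ℝ)
    (hA : ∀ (r : Fin m) (i j : Fin n), A r i j = if (j, r, i) ∈ E then 1 else 0)
    (δ : Fin m → ℝ) (τ : Fin m → Fin m → ℝ)
    (F : Matrix (Fin n) (Fin n) ℝ) (hF : F.IsDiag)
    (X : Matrix (Fin n) (Fin d) ℝ)
    (W : ℕ → Fin m → Matrix (Fin d) (Fin d) ℝ)
    (M : ℕ → Fin m → Matrix (Fin n) (Fin d) ℝ)
    (hM1 : ∀ r : Fin m, M 0 r = Real.exp (δ r) • (A r * F * X * (W 1 r).transpose))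
    (hMk : ∀ (k : ℕ) (r : Fin m), M (k + 1) r =
      Real.exp (δ r) •
        (A r * (∑ r' : Fin m, Real.exp (τ r' r) • M k r') * (W (k + 2) r).transpose))
    (k : ℕ) (r : Fin m) :
    M k r
      = ∑ s ∈ Finset.univ.filter (fun s : Fin (k + 1) → Fin m => s (Fin.last k) = r),
          Real.exp ((∑ t : Fin (k + 1), δ (s t)) +
              ∑ t : Fin k, τ (s t.castSucc) (s t.succ)) •
            ((List.ofFn fun t : Fin (k + 1) => A (s t.rev)).prod * F * X *
              (List.ofFn fun t : Fin (k + 1) => (W ((t : ℕ) + 1) (s t)).transpose).prod) := by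
  change M k r = ∑ s ∈ Finset.univ.filter (fun s : Fin (k + 1) → Fin m => s (Fin.last k) = r),
    pathTerm A δ τ F X W k s
  induction k generalizing r with
  | zero =>
    rw [sum_filter_last_eq, hM1, Fintype.sum_unique]
    simp [pathTerm, Fin.snoc]
  | succ k ih =>
    rw [sum_filter_last_eq, hMk]
    simp_rw [pathTerm_snoc]
    rw [← Finset.smul_sum, ← Matrix.sum_mul, ← Matrix.mul_sum]
    congr 3
    rw [← Finset.sum_fiberwise Finset.univ (fun s : Fin (k + 1) → Fin m => s (Fin.last k))]
    refine Finset.sum_congr rfl fun r' _ => ?_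
    rw [ih, Finset.smul_sum]
    refine Finset.sum_congr rfl fun s hs => ?_
    rw [(Finset.mem_filter.mp hs).2]
end

section
/- Let E ⊆ V × R × V be a multi-relational graph on n nodes with m relation types, with adjacency matrices A_r. Let φ : V → T be a node type map into a finite type T, let f, g : T → ℝ, δ : R → ℝ, τ : R × R → ℝ, and define for each k-hop relational path α(j, r_1, ..., r_k, i) = exp(f(φ(j)) + Σ_{t=1}^{k} δ(r_t) + Σ_{t=1}^{k-1} τ(r_t, r_{t+1}) + g(φ(i))), and β(r_1, ..., r_k) = exp(Σ_{t=1}^{k} δ(r_t) + Σ_{t=1}^{k-1} τ(r_t, r_{t+1})). Set F = diag(exp(f(φ(v_1))), ..., exp(f(φ(v_n)))) and G = diag(exp(g(φ(v_1))), ..., exp(g(φ(v_n)))). Then for every node i ∈ V, the normalization factor d_i^k = Σ over all k-hop relational paths (j, r_1, ..., r_k, i) ∈ Φ_k ending at i of α(j, r_1, ..., r_k, i) equals the i-th entry of the vector Σ_{(r_1, ..., r_k) ∈ R^k} β(r_1, ..., r_k) · G · A_{r_k} ⋯ A_{r_1} · F · 1_n, where 1_n is the all-ones vector. -/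
/-- Entries of the reversed product of a tuple of matrices, applied to a vector, as a sum over
walks `v` ending at `i`. -/
theorem Matrix.prod_ofFn_rev_mulVec_apply {ι R : Type*} [Fintype ι] [DecidableEq ι] [CommSemiring R]
    {k : ℕ} (M : Fin k → Matrix ι ι R) (x : ι → R) (i : ι) :
    ((List.ofFn fun t : Fin k => M t.rev).prod.mulVec x) i =
      ∑ v : Fin (k + 1) → ι, if v (Fin.last k) = i then
        x (v 0) * ∏ t : Fin k, M t (v t.succ) (v t.castSucc) else 0 := by
  induction k generalizing i with
  | zero =>
    rw [← (Equiv.funUnique (Fin 1) ι).symm.sum_comp]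
    simp
  | succ k ih =>
    rw [List.ofFn_succ, List.prod_cons, ← Matrix.mulVec_mulVec, Matrix.mulVec_eq_sum,
      ← (Fin.snocEquiv fun _ => ι).sum_comp, Fintype.sum_prod_type]
    simp only [Fin.rev_succ, Fin.rev_zero, Finset.sum_apply, ih fun t => M t.castSucc]
    simp only [Fin.snocEquiv, Equiv.coe_fn_mk, Fin.snoc_last, Fin.prod_univ_castSucc,
      Fin.succ_last, Fin.snoc_castSucc, ← Fin.castSucc_zero, Fin.succ_castSucc]
    symm
    rw [Fintype.sum_eq_single i fun a ha => by simp [ha]]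
    simp only [Pi.smul_apply, MulOpposite.smul_eq_mul_unop, MulOpposite.unop_op,
      Matrix.transpose_apply, if_true, Finset.mul_sum]
    rw [Finset.sum_comm]
    refine Finset.sum_congr rfl fun v _ => ?_
    simp [mul_left_comm, mul_comm]


/-- The normalization factor `d_i^k`, the sum of the attention scores
`α` over all `(k+1)`-hop relational paths ending at node `i`, equals the `i`-th entry of
`Σ_{(r_1, …, r_{k+1}) ∈ R^{k+1}} β(r_1, …, r_{k+1}) · G · A_{r_{k+1}} ⋯ A_{r_1} · F · 1_n`. -/
theorem stmt_5 (n m : ℕ) (E : Finset (Fin n × Fin m × Fin n))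
    (A : Fin m → Matrix (Fin n) (Fin n) ℝ)
    (hA : ∀ (r : Fin m) (i j : Fin n), A r i j = if (j, r, i) ∈ E then 1 else 0)
    (T : Type*) [Fintype T] (φ : Fin n → T)
    (f g : T → ℝ) (δ : Fin m → ℝ) (τ : Fin m → Fin m → ℝ)
    (k : ℕ)
    (F G : Matrix (Fin n) (Fin n) ℝ)
    (hF : F = Matrix.diagonal fun v => Real.exp (f (φ v)))
    (hG : G = Matrix.diagonal fun v => Real.exp (g (φ v)))
    (i : Fin n) :
    (∑ p ∈ Finset.univ.filter
        (fun p : (Fin (k + 2) → Fin n) × (Fin (k + 1) → Fin m) =>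
          p.1 (Fin.last (k + 1)) = i ∧
          ∀ t : Fin (k + 1), (p.1 t.castSucc, p.2 t, p.1 t.succ) ∈ E),
      Real.exp (f (φ (p.1 0)) + (∑ t : Fin (k + 1), δ (p.2 t)) +
          (∑ t : Fin k, τ (p.2 t.castSucc) (p.2 t.succ)) + g (φ i)))
      = (∑ r : Fin (k + 1) → Fin m,
          Real.exp ((∑ t : Fin (k + 1), δ (r t)) +
              ∑ t : Fin k, τ (r t.castSucc) (r t.succ)) •
            ((G * (List.ofFn fun t : Fin (k + 1) => A (r t.rev)).prod * F).mulVec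
              (fun _ => (1 : ℝ)))) i := by
  subst hF hG
  rw [Finset.sum_filter, Fintype.sum_prod_type_right, Finset.sum_apply]
  refine Finset.sum_congr rfl fun r _ => ?_
  rw [Pi.smul_apply, ← Matrix.mulVec_mulVec, ← Matrix.mulVec_mulVec, Matrix.mulVec_diagonal,
    Matrix.prod_ofFn_rev_mulVec_apply fun t => A (r t), smul_eq_mul, Finset.mul_sum,
    Finset.mul_sum]
  refine Finset.sum_congr rfl fun v _ => ?_
  simp only [hA, Finset.prod_ite_zero, Finset.prod_const_one, Matrix.mulVec_diagonal,
    Finset.mem_univ, true_implies, ite_and]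
  split_ifs
  · simp only [Real.exp_add]
    ring
  all_goals simp
end

section
/- Let E ⊆ V × R × V be a multi-relational graph on n nodes with m relation types, let φ : V → T be a node type map into a finite type T, and let f, g : T → ℝ, δ : R → ℝ, τ : R × R → ℝ. Define the log-attention score of a k-hop relational path as ℓ(j, r_1, ..., r_k, i) = f(φ(j)) + Σ_{t=1}^{k} δ(r_t) + Σ_{t=1}^{k-1} τ(r_t, r_{t+1}) + g(φ(i)). Define the dynamic-programming values in WithBot ℝ (with sup over the empty set equal to ⊥): V_r^{(1)}(i) = sup { f(φ(j)) + δ(r) : j ∈ V with (j, r, i) ∈ E }, and for k ≥ 2, V_r^{(k)}(i) = sup { V_{r'}^{(k-1)}(j) + τ(r', r) + δ(r) : r' ∈ R, j ∈ V with (j, r, i) ∈ E }. Then for every k ≥ 1, r ∈ R and i ∈ V: V_r^{(k)}(i) + g(φ(i)) equals the supremum of ℓ over all k-hop relational paths ending at node i whose last relation is r. In particular, a path maximizing the attention score α = exp(ℓ) can be found by this recurrence in time linear in k. -/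
/-- Adding a real constant commutes with finite suprema in `WithBot ℝ`. -/
theorem Finset.sup_withBot_add_coe {α : Type*} (s : Finset α) (F : α → WithBot ℝ) (c : ℝ) :
    s.sup F + (c : WithBot ℝ) = s.sup fun a => F a + (c : WithBot ℝ) :=
  Finset.apply_sup_eq_sup_comp (fun x : WithBot ℝ => x + (c : WithBot ℝ))
    (fun x y => (max_add_add_right x y _).symm) (WithBot.bot_add _)

section RelationalPath

variable {n m : ℕ} {T : Type*}

/-- The `k + 1`-hop relational paths of `E`, as pairs of a node sequence and a relation sequence,
that end at node `i` with last relation `r`. -/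
def relPaths (E : Finset (Fin n × Fin m × Fin n)) (k : ℕ) (r : Fin m) (i : Fin n) :
    Finset ((Fin (k + 2) → Fin n) × (Fin (k + 1) → Fin m)) :=
  Finset.univ.filter fun p =>
    p.2 (Fin.last k) = r ∧ p.1 (Fin.last (k + 1)) = i ∧
      ∀ t : Fin (k + 1), (p.1 t.castSucc, p.2 t, p.1 t.succ) ∈ E

/-- The log-attention score of a relational path without the contribution of its end node. -/
def relPathScore (φ : Fin n → T) (f : T → ℝ) (δ : Fin m → ℝ) (τ : Fin m → Fin m → ℝ) {k : ℕ}
    (p : (Fin (k + 2) → Fin n) × (Fin (k + 1) → Fin m)) : ℝ :=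
  f (φ (p.1 0)) + (∑ t : Fin (k + 1), δ (p.2 t)) +
    ∑ t : Fin k, τ (p.2 t.castSucc) (p.2 t.succ)

variable {E : Finset (Fin n × Fin m × Fin n)}

theorem mem_relPaths {k : ℕ} {r : Fin m} {i : Fin n}
    {p : (Fin (k + 2) → Fin n) × (Fin (k + 1) → Fin m)} :
    p ∈ relPaths E k r i ↔ p.2 (Fin.last k) = r ∧ p.1 (Fin.last (k + 1)) = i ∧
      ∀ t : Fin (k + 1), (p.1 t.castSucc, p.2 t, p.1 t.succ) ∈ E := by
  simp [relPaths]

/-- A path with one more hop is a path to the penultimate node followed by an edge. -/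
theorem mem_relPaths_succ {k : ℕ} {r : Fin m} {i : Fin n}
    {p : (Fin (k + 3) → Fin n) × (Fin (k + 2) → Fin m)} :
    p ∈ relPaths E (k + 1) r i ↔
      p.2 (Fin.last (k + 1)) = r ∧ p.1 (Fin.last (k + 2)) = i ∧
        (p.1 (Fin.last (k + 1)).castSucc, r, i) ∈ E ∧
        (Fin.init p.1, Fin.init p.2) ∈
          relPaths E k (p.2 (Fin.last k).castSucc) (p.1 (Fin.last (k + 1)).castSucc) := by
  simp only [mem_relPaths, Fin.forall_fin_succ' (n := k + 1), Fin.init, Fin.succ_last,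
    Fin.succ_castSucc]
  constructor
  · rintro ⟨rfl, rfl, h, h'⟩
    exact ⟨rfl, rfl, h', trivial, trivial, h⟩
  · rintro ⟨rfl, rfl, h', -, -, h⟩
    exact ⟨rfl, rfl, h, h'⟩

theorem relPathScore_succ (φ : Fin n → T) (f : T → ℝ) (δ : Fin m → ℝ) (τ : Fin m → Fin m → ℝ)
    {k : ℕ} (p : (Fin (k + 3) → Fin n) × (Fin (k + 2) → Fin m)) :
    relPathScore φ f δ τ p =
      relPathScore φ f δ τ (k := k) (Fin.init p.1, Fin.init p.2) +
        (τ (p.2 (Fin.last k).castSucc) (p.2 (Fin.last (k + 1))) + δ (p.2 (Fin.last (k + 1)))) := by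
  simp only [relPathScore, Fin.init, Fin.sum_univ_castSucc (n := k + 1),
    Fin.sum_univ_castSucc (n := k), Fin.succ_last, Fin.succ_castSucc, Fin.castSucc_zero]
  ring

/-- The dynamic-programming values are the maximal path scores, up to the end-node term. -/
theorem relPath_dp_eq_sup (φ : Fin n → T) (f : T → ℝ) (δ : Fin m → ℝ) (τ : Fin m → Fin m → ℝ)
    (Vdp : ℕ → Fin m → Fin n → WithBot ℝ)
    (hV1 : ∀ (r : Fin m) (i : Fin n), Vdp 0 r i =
      (Finset.univ.filter fun j : Fin n => (j, r, i) ∈ E).sup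
        (fun j => ((f (φ j) + δ r : ℝ) : WithBot ℝ)))
    (hVk : ∀ (k : ℕ) (r : Fin m) (i : Fin n), Vdp (k + 1) r i =
      (Finset.univ.filter fun p : Fin m × Fin n => (p.2, r, i) ∈ E).sup
        (fun p => Vdp k p.1 p.2 + ((τ p.1 r + δ r : ℝ) : WithBot ℝ)))
    (k : ℕ) (r : Fin m) (i : Fin n) :
    Vdp k r i =
      (relPaths E k r i).sup fun p => ((relPathScore φ f δ τ p : ℝ) : WithBot ℝ) := by
  induction k generalizing r i with
  | zero =>
    rw [hV1]
    apply le_antisymm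
    · refine Finset.sup_le fun j hj => ?_
      have hmem : ((![j, i], ![r]) : (Fin 2 → Fin n) × (Fin 1 → Fin m)) ∈ relPaths E 0 r i := by
        simpa [mem_relPaths] using hj
      refine le_of_eq_of_le ?_ (Finset.le_sup hmem)
      simp [relPathScore]
    · refine Finset.sup_le fun p hp => ?_
      obtain ⟨rfl, rfl, h⟩ := mem_relPaths.1 hp
      refine le_of_eq_of_le ?_ (Finset.le_sup (b := p.1 0) (by simpa using h 0))
      simp [relPathScore]
  | succ k ih =>
    rw [hVk]
    apply le_antisymm
    · refine Finset.sup_le fun q hq => ?_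
      rw [ih, Finset.sup_withBot_add_coe]
      refine Finset.sup_le fun p hp => ?_
      obtain ⟨hr, hi, -⟩ := mem_relPaths.1 hp
      have hmem : ((Fin.snoc p.1 i, Fin.snoc p.2 r) :
          (Fin (k + 3) → Fin n) × (Fin (k + 2) → Fin m)) ∈ relPaths E (k + 1) r i := by
        rw [mem_relPaths_succ]
        simp only [Fin.snoc_last, Fin.snoc_castSucc, Fin.init_snoc, hr, hi, true_and]
        exact ⟨by simpa using hq, hp⟩
      refine le_of_eq_of_le ?_ (Finset.le_sup hmem)
      rw [relPathScore_succ]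
      simp only [Fin.snoc_last, Fin.snoc_castSucc, Fin.init_snoc, hr, WithBot.coe_add]
    · refine Finset.sup_le fun p hp => ?_
      obtain ⟨rfl, rfl, he, hp'⟩ := mem_relPaths_succ.1 hp
      refine le_trans ?_ (Finset.le_sup
        (b := (p.2 (Fin.last k).castSucc, p.1 (Fin.last (k + 1)).castSucc)) (by simpa using he))
      rw [ih, Finset.sup_withBot_add_coe]
      refine le_of_eq_of_le ?_ (Finset.le_sup hp')
      rw [relPathScore_succ, WithBot.coe_add]

end RelationalPath


/-- Correctness of the dynamic-programming recurrence for decoding a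
path with maximal attention score: with `Vdp k r i` (indexed so that `Vdp k` is
`V^{(k+1)}` of the statement) defined by
`V_r^{(1)}(i) = sup { f(φ(j)) + δ(r) : (j, r, i) ∈ E }` and
`V_r^{(k)}(i) = sup { V_{r'}^{(k-1)}(j) + τ(r', r) + δ(r) : r' ∈ R, (j, r, i) ∈ E }`
(suprema in `WithBot ℝ`, with the empty supremum equal to `⊥`),
`V_r^{(k)}(i) + g(φ(i))` equals the supremum of the log-attention score `ℓ` over all
`k`-hop relational paths ending at node `i` whose last relation is `r`. -/
theorem stmt_6 (n m : ℕ) (E : Finset (Fin n × Fin m × Fin n))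
    (T : Type*) [Fintype T] (φ : Fin n → T)
    (f g : T → ℝ) (δ : Fin m → ℝ) (τ : Fin m → Fin m → ℝ)
    (Vdp : ℕ → Fin m → Fin n → WithBot ℝ)
    (hV1 : ∀ (r : Fin m) (i : Fin n), Vdp 0 r i =
      (Finset.univ.filter fun j : Fin n => (j, r, i) ∈ E).sup
        (fun j => ((f (φ j) + δ r : ℝ) : WithBot ℝ)))
    (hVk : ∀ (k : ℕ) (r : Fin m) (i : Fin n), Vdp (k + 1) r i =
      (Finset.univ.filter fun p : Fin m × Fin n => (p.2, r, i) ∈ E).sup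
        (fun p => Vdp k p.1 p.2 + ((τ p.1 r + δ r : ℝ) : WithBot ℝ)))
    (k : ℕ) (r : Fin m) (i : Fin n) :
    Vdp k r i + ((g (φ i) : ℝ) : WithBot ℝ)
      = (Finset.univ.filter
          (fun p : (Fin (k + 2) → Fin n) × (Fin (k + 1) → Fin m) =>
            p.2 (Fin.last k) = r ∧ p.1 (Fin.last (k + 1)) = i ∧
            ∀ t : Fin (k + 1), (p.1 t.castSucc, p.2 t, p.1 t.succ) ∈ E)).sup
        (fun p => ((f (φ (p.1 0)) + (∑ t : Fin (k + 1), δ (p.2 t)) +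
            (∑ t : Fin k, τ (p.2 t.castSucc) (p.2 t.succ)) + g (φ i) : ℝ) : WithBot ℝ)) := by
  rw [relPath_dp_eq_sup φ f δ τ Vdp hV1 hVk, Finset.sup_withBot_add_coe]
  simp only [← WithBot.coe_add]
  rfl
end
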